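/- arXiv:2201.05521 — 2 statements merged into one kernel-verified Lean document; each statement's English description precedes it below -/
import Mathlib

section
/- Let d ≥ 2, let 0 < a < b, and let f : A(a,b) → ℂ be twice continuously differentiable on the open annulus A(a,b) ⊂ ℝ^d. Let Y be a harmonic polynomial on ℝ^d, homogeneous of degree k. Define the Fourier–Laplace coefficient f_Y(r) = ∫_{S^{d-1}} f(rθ) Y(θ) dθ for r ∈ (a,b), where dθ is the surface measure on the unit sphere S^{d-1}. Then f_Y is twice differentiable on (a,b) and ∫_{S^{d-1}} (Δf)(rθ) Y(θ) dθ = L_k(f_Y)(r) for all r ∈ (a,b), where L_k(g)(r) = g''(r) + ((d-1)/r) g'(r) - (k(k+d-2)/r^2) g(r). -/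
open MeasureTheory Metric Set Filter Topology

noncomputable section

/-- The Laplace operator `Δf = ∑ ∂²f/∂xᵢ²` on `ℝᵈ`, for vector-valued functions. -/
def laplacian {d : ℕ} {V : Type*} [NormedAddCommGroup V] [NormedSpace ℝ V]
    (f : EuclideanSpace ℝ (Fin d) → V) (x : EuclideanSpace ℝ (Fin d)) : V :=
  ∑ i : Fin d, iteratedFDeriv ℝ 2 f x ![EuclideanSpace.single i 1, EuclideanSpace.single i 1]

/-- The open annulus `A(a,b) = {x ∈ ℝᵈ : a < |x| < b}`. -/
def annulus (d : ℕ) (a b : ℝ) : Set (EuclideanSpace ℝ (Fin d)) := {x | a < ‖x‖ ∧ ‖x‖ < b}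

/-- The surface measure on the unit sphere `S^{d-1}` of `ℝᵈ`. -/
def sphereMeasure (d : ℕ) : Measure (sphere (0 : EuclideanSpace ℝ (Fin d)) 1) :=
  (volume : Measure (EuclideanSpace ℝ (Fin d))).toSphere

instance isFiniteMeasure_sphereMeasure (d : ℕ) : IsFiniteMeasure (sphereMeasure d) :=
  inferInstanceAs (IsFiniteMeasure (Measure.toSphere volume))

section ParametricIntegral

variable {X V : Type*} [TopologicalSpace X] [CompactSpace X] [MeasurableSpace X]
  [OpensMeasurableSpace X] [NormedAddCommGroup V] [NormedSpace ℝ V]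
  [SecondCountableTopology X]

theorem hasDerivAt_integral_of_continuousOn (μ : Measure X) [IsFiniteMeasure μ]
    {F F' : ℝ → X → V} {U : Set ℝ} (hU : IsOpen U) {t : ℝ} (ht : t ∈ U)
    (hF : ∀ s ∈ U, Continuous (F s))
    (hF' : ContinuousOn (fun p : ℝ × X => F' p.1 p.2) (U ×ˢ univ))
    (hderiv : ∀ s ∈ U, ∀ x, HasDerivAt (fun s => F s x) (F' s x) s) :
    HasDerivAt (fun s => ∫ x, F s x ∂μ) (∫ x, F' t x ∂μ) t := by
  obtain ⟨ε, hε, hεU⟩ := Metric.nhds_basis_closedBall.mem_iff.1 (hU.mem_nhds ht)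
  have hcont : ∀ s ∈ U, Continuous (F' s) := fun s hs =>
    hF'.comp_continuous (f := fun x => (s, x)) (by fun_prop) fun x => ⟨hs, mem_univ x⟩
  obtain ⟨C, hC⟩ := ((isCompact_closedBall t ε).prod
    (isCompact_univ (X := X))).exists_bound_of_continuousOn (hF'.mono (prod_mono hεU subset_rfl))
  refine (hasDerivAt_integral_of_dominated_loc_of_deriv_le (bound := fun _ => C)
    (closedBall_mem_nhds t hε) ?_ ?_ ?_ ?_ (integrable_const C) ?_).2
  · filter_upwards [hU.mem_nhds ht] with s hs
    exact (hF s hs).aestronglyMeasurable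
  · exact (hF t ht).integrable_of_hasCompactSupport (HasCompactSupport.of_compactSpace _)
  · exact (hcont t ht).aestronglyMeasurable
  · exact .of_forall fun x s hs => hC (s, x) ⟨hs, mem_univ x⟩
  · exact .of_forall fun x s hs => hderiv s (hεU hs) x

end ParametricIntegral

section SphereInvariance

open scoped Pointwise

variable {E : Type*} [NormedAddCommGroup E] [InnerProductSpace ℝ E]

/-- The homeomorphism of the unit sphere induced by a linear isometry. -/
def sphereHomeomorph (R : E ≃ₗᵢ[ℝ] E) : sphere (0 : E) 1 ≃ₜ sphere (0 : E) 1 :=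
  R.toHomeomorph.subtype fun x => by simp

theorem sphereHomeomorph_coe (R : E ≃ₗᵢ[ℝ] E) (θ : sphere (0 : E) 1) :
    (sphereHomeomorph R θ : E) = R θ := rfl

variable [FiniteDimensional ℝ E] [MeasurableSpace E] [BorelSpace E]

theorem measurePreserving_sphereHomeomorph (R : E ≃ₗᵢ[ℝ] E) :
    MeasurePreserving (sphereHomeomorph R) (volume : Measure E).toSphere
      (volume : Measure E).toSphere := by
  refine ⟨(sphereHomeomorph R).measurable, ?_⟩
  ext s hs
  rw [Measure.map_apply (sphereHomeomorph R).measurable hs,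
    Measure.toSphere_apply' _ hs,
    Measure.toSphere_apply' _ ((sphereHomeomorph R).measurable hs)]
  have himage : Ioo (0 : ℝ) 1 • (((↑) : sphere (0 : E) 1 → E) '' (sphereHomeomorph R ⁻¹' s)) =
      R ⁻¹' (Ioo (0 : ℝ) 1 • (((↑) : sphere (0 : E) 1 → E) '' s)) := by
    ext x
    simp only [Set.mem_smul, mem_preimage]
    constructor
    · rintro ⟨c, hc, _, ⟨θ, hθ, rfl⟩, rfl⟩
      exact ⟨c, hc, _, ⟨_, hθ, rfl⟩, by simp [sphereHomeomorph_coe]⟩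
    · rintro ⟨c, hc, _, ⟨θ, hθ, rfl⟩, hx⟩
      refine ⟨c, hc, _, ⟨(sphereHomeomorph R).symm θ, by simpa using hθ, rfl⟩, ?_⟩
      apply R.injective
      rw [map_smul, ← sphereHomeomorph_coe, Homeomorph.apply_symm_apply]
      exact hx
  rw [himage, R.measurePreserving.measure_preimage_emb
    R.toHomeomorph.measurableEmbedding]

theorem integral_toSphere_comp_linearIsometryEquiv {V : Type*} [NormedAddCommGroup V]
    [NormedSpace ℝ V] (R : E ≃ₗᵢ[ℝ] E) (h : E → V) :
    ∫ θ : sphere (0 : E) 1, h (R θ) ∂(volume : Measure E).toSphere =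
      ∫ θ : sphere (0 : E) 1, h θ ∂(volume : Measure E).toSphere :=
  (measurePreserving_sphereHomeomorph R).integral_comp
    (sphereHomeomorph R).measurableEmbedding (fun θ => h θ)

end SphereInvariance

section AngularDerivative

variable {d : ℕ} {V : Type*} [NormedAddCommGroup V] [NormedSpace ℝ V]

/-- The rotation of `ℝᵈ` by the angle `t` in the plane of the `i`-th and `j`-th coordinates. -/
def planeRotation (i j : Fin d) (t : ℝ) (x : EuclideanSpace ℝ (Fin d)) :
    EuclideanSpace ℝ (Fin d) :=
  x + (Real.cos t - 1) • (x i • EuclideanSpace.single i 1 + x j • EuclideanSpace.single j 1) +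
    Real.sin t • (x i • EuclideanSpace.single j 1 - x j • EuclideanSpace.single i 1)

/-- The rotation in a coordinate plane as a linear isometric equivalence. -/
def planeRotationEquiv {i j : Fin d} (hij : i ≠ j) (t : ℝ) :
    EuclideanSpace ℝ (Fin d) ≃ₗᵢ[ℝ] EuclideanSpace ℝ (Fin d) :=
  LinearIsometry.toLinearIsometryEquiv
    { toFun := planeRotation i j t
      map_add' := fun x y => by
        simp only [planeRotation, PiLp.add_apply]
        module
      map_smul' := fun c x => by
        simp only [planeRotation, PiLp.smul_apply, smul_eq_mul, RingHom.id_apply]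
        module
      norm_map' := fun x => by
        have hsq : ‖planeRotation i j t x‖ ^ 2 = ‖x‖ ^ 2 := by
          have hrw : planeRotation i j t x =
              x + (((Real.cos t - 1) * x i - Real.sin t * x j) • EuclideanSpace.single i 1 +
                ((Real.cos t - 1) * x j + Real.sin t * x i) • EuclideanSpace.single j 1) := by
            simp only [planeRotation]
            module
          rw [hrw, norm_add_sq_real, ← real_inner_self_eq_norm_sq (_ + _)]
          simp only [inner_add_left, inner_add_right, inner_smul_left, inner_smul_right,
            EuclideanSpace.inner_single_right]
          simp [hij, hij.symm]
          linear_combination (x i ^ 2 + x j ^ 2) * Real.sin_sq_add_cos_sq t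
        exact (sq_eq_sq₀ (norm_nonneg _) (norm_nonneg _)).1 hsq } rfl

theorem planeRotationEquiv_apply {i j : Fin d} (hij : i ≠ j) (t : ℝ)
    (x : EuclideanSpace ℝ (Fin d)) : planeRotationEquiv hij t x = planeRotation i j t x := rfl

/-- The infinitesimal rotation `x ↦ xᵢ eⱼ - xⱼ eᵢ`. -/
def planeGenerator (i j : Fin d) : EuclideanSpace ℝ (Fin d) →L[ℝ] EuclideanSpace ℝ (Fin d) :=
  (EuclideanSpace.proj i).smulRight (EuclideanSpace.single j 1) -
    (EuclideanSpace.proj j).smulRight (EuclideanSpace.single i 1)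

theorem planeGenerator_apply (i j : Fin d) (x : EuclideanSpace ℝ (Fin d)) :
    planeGenerator i j x =
      x i • EuclideanSpace.single j 1 - x j • EuclideanSpace.single i 1 := rfl

/-- The angular derivative `xᵢ ∂ⱼ - xⱼ ∂ᵢ`. -/
def angularDeriv (i j : Fin d) (u : EuclideanSpace ℝ (Fin d) → V)
    (x : EuclideanSpace ℝ (Fin d)) : V :=
  fderiv ℝ u x (planeGenerator i j x)

theorem integral_angularDeriv_eq_zero (i j : Fin d) {r : ℝ} {Ω : Set (EuclideanSpace ℝ (Fin d))}
    (hΩ : IsOpen Ω) (hr : ∀ x, ‖x‖ = |r| → x ∈ Ω) {u : EuclideanSpace ℝ (Fin d) → V}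
    (hu : ContDiffOn ℝ 1 u Ω) :
    ∫ θ, angularDeriv i j u (r • (θ : EuclideanSpace ℝ (Fin d))) ∂(sphereMeasure d) = 0 := by
  rcases eq_or_ne i j with rfl | hij
  · simp [angularDeriv, planeGenerator_apply]
  have hmem : ∀ (t : ℝ) (θ : sphere (0 : EuclideanSpace ℝ (Fin d)) 1),
      r • planeRotation i j t θ ∈ Ω := fun t θ => hr _ (by
    rw [← planeRotationEquiv_apply hij, norm_smul, LinearIsometryEquiv.norm_map]
    simp)
  have hrot : Continuous fun p : ℝ × sphere (0 : EuclideanSpace ℝ (Fin d)) 1 =>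
      r • planeRotation i j p.1 p.2 := by
    unfold planeRotation
    fun_prop
  have hfd : ContinuousOn (fderiv ℝ u) Ω := hu.continuousOn_fderiv_of_isOpen hΩ le_rfl
  set R' : ℝ → EuclideanSpace ℝ (Fin d) → EuclideanSpace ℝ (Fin d) := fun t x =>
    (-Real.sin t) • (x i • EuclideanSpace.single i 1 + x j • EuclideanSpace.single j 1) +
      Real.cos t • planeGenerator i j x with hR'
  have key := hasDerivAt_integral_of_continuousOn (sphereMeasure d)
    (F := fun t θ => u (r • planeRotation i j t θ))
    (F' := fun t θ => fderiv ℝ u (r • planeRotation i j t θ) (r • R' t θ))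
    isOpen_univ (mem_univ (0 : ℝ)) ?_ ?_ ?_
  · have hconst : ∀ t : ℝ, ∫ θ, u (r • planeRotation i j t θ) ∂(sphereMeasure d) =
        ∫ θ, u (r • (θ : EuclideanSpace ℝ (Fin d))) ∂(sphereMeasure d) := fun t =>
      integral_toSphere_comp_linearIsometryEquiv (planeRotationEquiv hij t) (fun x => u (r • x))
    have hzero := (hasDerivAt_const (0 : ℝ)
      (∫ θ, u (r • (θ : EuclideanSpace ℝ (Fin d))) ∂(sphereMeasure d))).unique
        (by simpa only [hconst] using key)
    rw [hzero]
    simp [angularDeriv, hR', planeRotation]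
  · intro t _
    exact hu.continuousOn.comp_continuous
      (hrot.comp (by fun_prop : Continuous fun θ => (t, θ))) (hmem t)
  · refine Continuous.continuousOn ?_
    refine (hfd.comp_continuous hrot fun p => hmem p.1 p.2).clm_apply ?_
    simp only [hR']
    fun_prop
  · intro t _ θ
    have h1 : HasDerivAt (fun t => r • planeRotation i j t θ) (r • R' t θ) t := by
      refine HasDerivAt.const_smul r ?_
      have h2 := (((Real.hasDerivAt_cos t).sub_const 1).smul_const
        ((θ : EuclideanSpace ℝ (Fin d)) i • EuclideanSpace.single i (1 : ℝ) +
          (θ : EuclideanSpace ℝ (Fin d)) j • EuclideanSpace.single j (1 : ℝ))).const_add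
            (θ : EuclideanSpace ℝ (Fin d))
      exact h2.add ((Real.hasDerivAt_sin t).smul_const
        (planeGenerator i j (θ : EuclideanSpace ℝ (Fin d))))
    have h3 := ((hu.differentiableOn one_ne_zero).differentiableAt
      (hΩ.mem_nhds (hmem t θ))).hasFDerivAt
    exact h3.comp_hasDerivAt t h1

theorem ContDiffOn.angularDeriv {m n : WithTop ℕ∞} {Ω : Set (EuclideanSpace ℝ (Fin d))}
    (hΩ : IsOpen Ω) {u : EuclideanSpace ℝ (Fin d) → V} (hu : ContDiffOn ℝ n u Ω)
    (hmn : m + 1 ≤ n) (i j : Fin d) : ContDiffOn ℝ m (angularDeriv i j u) Ω :=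
  (hu.fderiv_of_isOpen hΩ hmn).clm_apply (planeGenerator i j).contDiff.contDiffOn

theorem angularDeriv_smul_sub_smul (i j : Fin d) {w : EuclideanSpace ℝ (Fin d) → ℝ}
    {u : EuclideanSpace ℝ (Fin d) → V} {Ω : Set (EuclideanSpace ℝ (Fin d))} (hΩ : IsOpen Ω)
    (hw : ContDiffOn ℝ 2 w Ω) (hu : ContDiffOn ℝ 2 u Ω)
    {x : EuclideanSpace ℝ (Fin d)} (hx : x ∈ Ω) :
    angularDeriv i j (fun y => w y • angularDeriv i j u y - angularDeriv i j w y • u y) x =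
      w x • angularDeriv i j (angularDeriv i j u) x -
        angularDeriv i j (angularDeriv i j w) x • u x := by
  have hxΩ := hΩ.mem_nhds hx
  have hw0 := (((hw.of_le one_le_two).differentiableOn
    one_ne_zero).differentiableAt hxΩ).hasFDerivAt
  have hu0 := (((hu.of_le one_le_two).differentiableOn
    one_ne_zero).differentiableAt hxΩ).hasFDerivAt
  have hw1 := (((hw.angularDeriv (m := 1) hΩ (by norm_num) i j).differentiableOn
    one_ne_zero).differentiableAt hxΩ).hasFDerivAt
  have hu1 := (((hu.angularDeriv (m := 1) hΩ (by norm_num) i j).differentiableOn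
    one_ne_zero).differentiableAt hxΩ).hasFDerivAt
  have h := ((hw0.fun_smul hu1).fun_sub (hw1.fun_smul hu0)).fderiv
  rw [_root_.angularDeriv, h]
  simp only [_root_.angularDeriv, sub_apply, add_apply,
    smul_apply, ContinuousLinearMap.smulRight_apply]
  abel

theorem angularDeriv_angularDeriv (i j : Fin d) {u : EuclideanSpace ℝ (Fin d) → V}
    {x : EuclideanSpace ℝ (Fin d)} (hu : DifferentiableAt ℝ (fderiv ℝ u) x) :
    angularDeriv i j (angularDeriv i j u) x =
      fderiv ℝ (fderiv ℝ u) x (planeGenerator i j x) (planeGenerator i j x) +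
        fderiv ℝ u x (planeGenerator i j (planeGenerator i j x)) := by
  have h := (hu.hasFDerivAt.clm_apply (planeGenerator i j).hasFDerivAt).fderiv
  change fderiv ℝ (fun y => fderiv ℝ u y (planeGenerator i j y)) x (planeGenerator i j x) = _
  rw [h]
  simp [add_comm]

theorem sum_smul_single (x : EuclideanSpace ℝ (Fin d)) :
    ∑ i, x i • EuclideanSpace.single i (1 : ℝ) = x := by
  simpa using (EuclideanSpace.basisFun (Fin d) ℝ).sum_repr x

theorem laplacian_eq_sum (u : EuclideanSpace ℝ (Fin d) → V) (x : EuclideanSpace ℝ (Fin d)) :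
    laplacian u x = ∑ i, fderiv ℝ (fderiv ℝ u) x (EuclideanSpace.single i 1)
      (EuclideanSpace.single i 1) := by
  simp [laplacian, iteratedFDeriv_two_apply]

theorem sum_angularDeriv_angularDeriv {u : EuclideanSpace ℝ (Fin d) → V}
    {x : EuclideanSpace ℝ (Fin d)} (hu : DifferentiableAt ℝ (fderiv ℝ u) x) :
    ∑ i, ∑ j, angularDeriv i j (angularDeriv i j u) x =
      (2 : ℝ) • (‖x‖ ^ 2 • laplacian u x - fderiv ℝ (fderiv ℝ u) x x x -
        ((d : ℝ) - 1) • fderiv ℝ u x x) := by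
  set B := fderiv ℝ (fderiv ℝ u) x with hB
  set D := fderiv ℝ u x with hD
  have hDx : D x = ∑ i, x i • D (EuclideanSpace.single i 1) := by
    conv_lhs => rw [← sum_smul_single x]
    simp
  have hBx : B x x = ∑ i, ∑ j, (x i * x j) •
      B (EuclideanSpace.single i 1) (EuclideanSpace.single j 1) := by
    conv_lhs => rw [← sum_smul_single x]
    simp only [map_sum, map_smul, sum_apply, smul_apply, Finset.smul_sum, smul_smul]
    rw [Finset.sum_comm]
    exact Finset.sum_congr rfl fun i _ => Finset.sum_congr rfl fun j _ => by rw [mul_comm]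
  have hterm : ∀ i j, angularDeriv i j (angularDeriv i j u) x =
      (x i ^ 2) • B (EuclideanSpace.single j 1) (EuclideanSpace.single j 1) +
      (x j ^ 2) • B (EuclideanSpace.single i 1) (EuclideanSpace.single i 1) -
      (x i * x j) • B (EuclideanSpace.single i 1) (EuclideanSpace.single j 1) -
      (x j * x i) • B (EuclideanSpace.single j 1) (EuclideanSpace.single i 1) -
      x i • D (EuclideanSpace.single i 1) - x j • D (EuclideanSpace.single j 1) +
      (if i = j then x i • D (EuclideanSpace.single i 1) else 0) +
      (if i = j then x i • D (EuclideanSpace.single i 1) else 0) := by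
    intro i j
    rw [angularDeriv_angularDeriv i j hu, ← hB, ← hD]
    simp only [planeGenerator_apply, map_sub, map_smul, sub_apply, smul_apply]
    rcases eq_or_ne i j with rfl | hij
    · simp
      module
    · simp [hij, hij.symm]
      module
  have hswap : ∑ i, ∑ j, (x j * x i) •
      B (EuclideanSpace.single j 1) (EuclideanSpace.single i 1) = B x x := by
    rw [hBx, Finset.sum_comm]
  simp only [hterm, Finset.sum_add_distrib, Finset.sum_sub_distrib, hswap, ← hBx]
  simp only [← Finset.smul_sum, ← Finset.sum_smul, Finset.sum_ite_eq, Finset.mem_univ, if_true,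
    Finset.sum_const, Finset.card_univ, Fintype.card_fin, ← hDx, ← laplacian_eq_sum, hB,
    ← EuclideanSpace.real_norm_sq_eq]
  simp only [← Nat.cast_smul_eq_nsmul ℝ]
  simp only [smul_comm _ (d : ℝ), ← Finset.smul_sum, ← hDx]
  module

end AngularDerivative

section RadialDerivative

variable {E V : Type*} [NormedAddCommGroup E] [NormedSpace ℝ E] [NormedAddCommGroup V]
  [NormedSpace ℝ V] {u : E → V} {x : E} {s : ℝ}

theorem hasDerivAt_comp_smul (hu : DifferentiableAt ℝ u (s • x)) :
    HasDerivAt (fun ρ : ℝ => u (ρ • x)) (fderiv ℝ u (s • x) x) s := by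
  have h : HasDerivAt (fun ρ : ℝ => ρ • x) x s := by
    simpa using (hasDerivAt_id s).smul_const x
  exact hu.hasFDerivAt.comp_hasDerivAt s h

theorem hasDerivAt_fderiv_smul_apply (hu : DifferentiableAt ℝ (fderiv ℝ u) (s • x)) :
    HasDerivAt (fun ρ : ℝ => fderiv ℝ u (ρ • x) x)
      (fderiv ℝ (fderiv ℝ u) (s • x) x x) s :=
  (ContinuousLinearMap.apply ℝ V x).hasFDerivAt.comp_hasDerivAt s (hasDerivAt_comp_smul hu)

end RadialDerivative

section Euler

variable {d k : ℕ} {Y : EuclideanSpace ℝ (Fin d) → ℝ}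

theorem fderiv_apply_self_of_homogeneous (hY : ContDiff ℝ 2 Y)
    (hhom : ∀ (t : ℝ) x, Y (t • x) = t ^ k * Y x) (x : EuclideanSpace ℝ (Fin d)) :
    fderiv ℝ Y x x = k * Y x := by
  have h1 : HasDerivAt (fun t : ℝ => Y (t • x)) (fderiv ℝ Y x x) 1 := by
    simpa only [one_smul] using
      hasDerivAt_comp_smul (hY.differentiable two_ne_zero ((1 : ℝ) • x))
  have h3 : HasDerivAt (fun t : ℝ => Y (t • x)) (k * Y x) 1 := by
    simp only [hhom]
    simpa using (hasDerivAt_pow k (1 : ℝ)).mul_const (Y x)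
  exact h1.unique h3

theorem fderiv_fderiv_apply_self_of_homogeneous (hY : ContDiff ℝ 2 Y)
    (hhom : ∀ (t : ℝ) x, Y (t • x) = t ^ k * Y x) (x : EuclideanSpace ℝ (Fin d)) :
    fderiv ℝ (fderiv ℝ Y) x x x = k * (k - 1) * Y x := by
  have hd : DifferentiableAt ℝ (fderiv ℝ Y) x :=
    (hY.fderiv_right (m := 1) (by norm_num)).differentiable one_ne_zero x
  have h1 := (hd.hasFDerivAt.clm_apply (hasFDerivAt_id x)).fderiv
  have h2 : (fun y => fderiv ℝ Y y (id y)) = fun y => (k : ℝ) * Y y :=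
    funext (fderiv_apply_self_of_homogeneous hY hhom)
  rw [h2, fderiv_const_mul (hY.differentiable two_ne_zero x)] at h1
  have h3 := congrArg (fun T => T x) h1
  simp [fderiv_apply_self_of_homogeneous hY hhom] at h3
  linarith

theorem sum_angularDeriv_angularDeriv_of_harmonic (hY : ContDiff ℝ 2 Y)
    (hhom : ∀ (t : ℝ) x, Y (t • x) = t ^ k * Y x) (hharm : ∀ x, laplacian Y x = 0)
    (x : EuclideanSpace ℝ (Fin d)) :
    ∑ i, ∑ j, angularDeriv i j (angularDeriv i j Y) x = -2 * (k * (k + d - 2)) * Y x := by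
  rw [sum_angularDeriv_angularDeriv
    ((hY.fderiv_right (m := 1) (by norm_num)).differentiable one_ne_zero x), hharm,
    fderiv_apply_self_of_homogeneous hY hhom, fderiv_fderiv_apply_self_of_homogeneous hY hhom]
  simp only [smul_eq_mul]
  ring

end Euler

theorem integral_laplacian_mul_harmonic {d k : ℕ} {Y : EuclideanSpace ℝ (Fin d) → ℝ}
    (hY : ContDiff ℝ 2 Y) (hhom : ∀ (t : ℝ) x, Y (t • x) = t ^ k * Y x)
    (hharm : ∀ x, laplacian Y x = 0) {Ω : Set (EuclideanSpace ℝ (Fin d))} (hΩ : IsOpen Ω)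
    {V : Type*} [NormedAddCommGroup V] [NormedSpace ℝ V]
    {f : EuclideanSpace ℝ (Fin d) → V} (hf : ContDiffOn ℝ 2 f Ω) {r : ℝ} (hr0 : 0 < r)
    (hr : ∀ x, ‖x‖ = r → x ∈ Ω) :
    ∫ θ : sphere (0 : EuclideanSpace ℝ (Fin d)) 1, Y θ •
      (r ^ 2 • laplacian f (r • (θ : EuclideanSpace ℝ (Fin d))) -
        r ^ 2 • fderiv ℝ (fderiv ℝ f) (r • (θ : EuclideanSpace ℝ (Fin d))) θ θ -
        (((d : ℝ) - 1) * r) • fderiv ℝ f (r • (θ : EuclideanSpace ℝ (Fin d))) θ +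
        ((k : ℝ) * (k + d - 2)) • f (r • (θ : EuclideanSpace ℝ (Fin d)))) ∂(sphereMeasure d) = 0 := by
  have hmem : ∀ θ : sphere (0 : EuclideanSpace ℝ (Fin d)) 1,
      r • (θ : EuclideanSpace ℝ (Fin d)) ∈ Ω := fun θ => hr _ (by
    simp [norm_smul, abs_of_pos hr0])
  set w : Fin d → Fin d → EuclideanSpace ℝ (Fin d) → V := fun i j y =>
    Y y • angularDeriv i j f y - angularDeriv i j Y y • f y with hw
  have hwc : ∀ i j, ContDiffOn ℝ 1 (w i j) Ω := fun i j =>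
    ((hY.contDiffOn.of_le one_le_two).smul (hf.angularDeriv hΩ (by norm_num) i j)).sub
      ((hY.contDiffOn.angularDeriv hΩ (by norm_num) i j).smul (hf.of_le one_le_two))
  have hInt : ∀ i j, Integrable (fun θ : sphere (0 : EuclideanSpace ℝ (Fin d)) 1 =>
      angularDeriv i j (w i j) (r • (θ : EuclideanSpace ℝ (Fin d)))) (sphereMeasure d) :=
    fun i j => Continuous.integrable_of_hasCompactSupport
      (((hwc i j).angularDeriv (m := 0) hΩ (by norm_num) i j).continuousOn.comp_continuous
        (by fun_prop) hmem) (HasCompactSupport.of_compactSpace _)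
  have hsum : ∫ θ : sphere (0 : EuclideanSpace ℝ (Fin d)) 1, ∑ i, ∑ j,
      angularDeriv i j (w i j) (r • (θ : EuclideanSpace ℝ (Fin d))) ∂(sphereMeasure d) = 0 := by
    rw [integral_finsetSum _ fun i _ => integrable_finsetSum _ fun j _ => hInt i j]
    refine Finset.sum_eq_zero fun i _ => ?_
    rw [integral_finsetSum _ fun j _ => hInt i j]
    exact Finset.sum_eq_zero fun j _ => integral_angularDeriv_eq_zero i j hΩ
      (by rwa [abs_of_pos hr0]) (hwc i j)
  have hpoint : ∀ θ : sphere (0 : EuclideanSpace ℝ (Fin d)) 1, ∑ i, ∑ j,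
      angularDeriv i j (w i j) (r • (θ : EuclideanSpace ℝ (Fin d))) = (2 * r ^ k) • (Y θ •
      (r ^ 2 • laplacian f (r • (θ : EuclideanSpace ℝ (Fin d))) -
        r ^ 2 • fderiv ℝ (fderiv ℝ f) (r • (θ : EuclideanSpace ℝ (Fin d))) θ θ -
        (((d : ℝ) - 1) * r) • fderiv ℝ f (r • (θ : EuclideanSpace ℝ (Fin d))) θ +
        ((k : ℝ) * (k + d - 2)) • f (r • (θ : EuclideanSpace ℝ (Fin d))))) := by
    intro θ
    have hdf : DifferentiableAt ℝ (fderiv ℝ f) (r • (θ : EuclideanSpace ℝ (Fin d))) :=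
      ((hf.fderiv_of_isOpen (m := 1) hΩ (by norm_num)).differentiableOn
        one_ne_zero).differentiableAt (hΩ.mem_nhds (hmem θ))
    simp only [hw, angularDeriv_smul_sub_smul _ _ hΩ hY.contDiffOn hf (hmem θ),
      Finset.sum_sub_distrib, ← Finset.smul_sum, ← Finset.sum_smul,
      sum_angularDeriv_angularDeriv hdf,
      sum_angularDeriv_angularDeriv_of_harmonic hY hhom hharm, hhom]
    have hnorm : ‖r • (θ : EuclideanSpace ℝ (Fin d))‖ = r := by
      simp [norm_smul, abs_of_pos hr0]
    rw [hnorm]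
    simp only [map_smul, smul_apply]
    module
  simp only [hpoint, integral_smul] at hsum
  exact (smul_eq_zero.1 hsum).resolve_left (by positivity)

theorem isOpen_annulus (d : ℕ) (a b : ℝ) : IsOpen (annulus d a b) :=
  (isOpen_lt continuous_const continuous_norm).inter (isOpen_lt continuous_norm continuous_const)

/-- The Fourier–Laplace coefficient of `f` with respect to a spherical harmonic `Y`
satisfies `∫_{S^{d-1}} (Δf)(rθ) Y(θ) dθ = L_k(f_Y)(r)`, where
`L_k(g) = g'' + ((d-1)/r) g' - (k(k+d-2)/r²) g`. -/
theorem fourierLaplace_coefficient_laplacian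
    (d k : ℕ) (hd : 2 ≤ d) (a b : ℝ) (ha : 0 < a) (hab : a < b)
    (f : EuclideanSpace ℝ (Fin d) → ℂ)
    (hf : ContDiffOn ℝ 2 f (annulus d a b))
    (P : MvPolynomial (Fin d) ℝ) (hhom : P.IsHomogeneous k)
    (Y : EuclideanSpace ℝ (Fin d) → ℝ)
    (hY : ∀ x, Y x = MvPolynomial.eval (fun i => x i) P)
    (hharm : ∀ x, laplacian Y x = 0)
    (g : ℝ → ℂ)
    (hg : ∀ ρ : ℝ, g ρ = ∫ θ, f (ρ • (θ : EuclideanSpace ℝ (Fin d))) *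
      ((Y (θ : EuclideanSpace ℝ (Fin d)) : ℝ) : ℂ) ∂(sphereMeasure d)) :
    ∀ r ∈ Ioo a b,
      DifferentiableAt ℝ g r ∧ DifferentiableAt ℝ (deriv g) r ∧
      (∫ θ, laplacian f (r • (θ : EuclideanSpace ℝ (Fin d))) *
          ((Y (θ : EuclideanSpace ℝ (Fin d)) : ℝ) : ℂ) ∂(sphereMeasure d)) =
        deriv (deriv g) r + (((d : ℂ) - 1) / (r : ℂ)) * deriv g r -
          (((k : ℂ) * ((k : ℂ) + (d : ℂ) - 2)) / (r : ℂ) ^ 2) * g r := by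
  have hYc : ContDiff ℝ 2 Y := by
    have hYfun : Y = fun x => MvPolynomial.eval (fun i => x i) P := funext hY
    rw [hYfun]
    simp only [MvPolynomial.eval_eq]
    fun_prop
  have hYhom : ∀ (t : ℝ) x, Y (t • x) = t ^ k * Y x := by
    intro t x
    rw [hY, hY, MvPolynomial.eval_eq, MvPolynomial.eval_eq, Finset.mul_sum]
    refine Finset.sum_congr rfl fun m hm => ?_
    have hdeg : ∑ i ∈ m.support, m i = k := by
      have := hhom (MvPolynomial.mem_support_iff.1 hm)
      rwa [Pi.one_def, ← Finsupp.degree_eq_weight_one, Finsupp.degree_apply] at this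
    simp only [PiLp.smul_apply, smul_eq_mul, mul_pow, Finset.prod_mul_distrib,
      Finset.prod_pow_eq_pow_sum, hdeg]
    ring
  have hΩ := isOpen_annulus d a b
  have hmem : ∀ ρ ∈ Ioo a b, ∀ θ : sphere (0 : EuclideanSpace ℝ (Fin d)) 1,
      ρ • (θ : EuclideanSpace ℝ (Fin d)) ∈ annulus d a b := by
    intro ρ hρ θ
    simpa [annulus, norm_smul, abs_of_pos (ha.trans hρ.1)] using hρ
  have hf1 : ContDiffOn ℝ 1 (fderiv ℝ f) (annulus d a b) :=
    hf.fderiv_of_isOpen hΩ (by norm_num)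
  have hf2 : ContinuousOn (fderiv ℝ (fderiv ℝ f)) (annulus d a b) :=
    hf1.continuousOn_fderiv_of_isOpen hΩ le_rfl
  have hpolar : ContinuousOn (fun p : ℝ × sphere (0 : EuclideanSpace ℝ (Fin d)) 1 =>
      p.1 • (p.2 : EuclideanSpace ℝ (Fin d))) (Ioo a b ×ˢ univ) := by fun_prop
  have hmaps : MapsTo (fun p : ℝ × sphere (0 : EuclideanSpace ℝ (Fin d)) 1 =>
      p.1 • (p.2 : EuclideanSpace ℝ (Fin d))) (Ioo a b ×ˢ univ) (annulus d a b) :=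
    fun p hp => hmem p.1 hp.1 p.2
  have hYsc : Continuous fun θ : sphere (0 : EuclideanSpace ℝ (Fin d)) 1 => Y θ :=
    hYc.continuous.comp continuous_subtype_val
  have hv : Continuous fun θ : sphere (0 : EuclideanSpace ℝ (Fin d)) 1 =>
    (θ : EuclideanSpace ℝ (Fin d)) := continuous_subtype_val
  set F0 : ℝ → sphere (0 : EuclideanSpace ℝ (Fin d)) 1 → ℂ :=
    fun ρ θ => Y θ • f (ρ • (θ : EuclideanSpace ℝ (Fin d))) with hF0
  set F1 : ℝ → sphere (0 : EuclideanSpace ℝ (Fin d)) 1 → ℂ :=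
    fun ρ θ => Y θ • fderiv ℝ f (ρ • (θ : EuclideanSpace ℝ (Fin d))) θ with hF1
  set F2 : ℝ → sphere (0 : EuclideanSpace ℝ (Fin d)) 1 → ℂ :=
    fun ρ θ => Y θ • fderiv ℝ (fderiv ℝ f) (ρ • (θ : EuclideanSpace ℝ (Fin d))) θ θ with hF2
  have hc1 : ContinuousOn (fun p : ℝ × sphere (0 : EuclideanSpace ℝ (Fin d)) 1 => F1 p.1 p.2)
      (Ioo a b ×ˢ univ) :=
    (hYsc.comp continuous_snd).continuousOn.smul
      ((hf1.continuousOn.comp hpolar hmaps).clm_apply (hv.comp continuous_snd).continuousOn)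
  have hc2 : ContinuousOn (fun p : ℝ × sphere (0 : EuclideanSpace ℝ (Fin d)) 1 => F2 p.1 p.2)
      (Ioo a b ×ˢ univ) :=
    (hYsc.comp continuous_snd).continuousOn.smul
      (((hf2.comp hpolar hmaps).clm_apply (hv.comp continuous_snd).continuousOn).clm_apply
        (hv.comp continuous_snd).continuousOn)
  have hs0 : ∀ ρ ∈ Ioo a b, Continuous (F0 ρ) := fun ρ hρ =>
    hYsc.smul (hf.continuousOn.comp_continuous (by fun_prop) (hmem ρ hρ))
  have hs1 : ∀ ρ ∈ Ioo a b, Continuous (F1 ρ) := fun ρ hρ =>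
    hc1.comp_continuous (f := fun θ => (ρ, θ)) (by fun_prop) fun θ => ⟨hρ, mem_univ θ⟩
  have hs2 : ∀ ρ ∈ Ioo a b, Continuous (F2 ρ) := fun ρ hρ =>
    hc2.comp_continuous (f := fun θ => (ρ, θ)) (by fun_prop) fun θ => ⟨hρ, mem_univ θ⟩
  have hgF : g = fun ρ => ∫ θ, F0 ρ θ ∂(sphereMeasure d) := by
    funext ρ
    simp only [hg, hF0, Complex.real_smul, mul_comm]
  have hg1 : ∀ ρ ∈ Ioo a b, HasDerivAt g (∫ θ, F1 ρ θ ∂(sphereMeasure d)) ρ := by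
    intro ρ hρ
    rw [hgF]
    refine hasDerivAt_integral_of_continuousOn (sphereMeasure d) isOpen_Ioo hρ hs0 hc1
      fun s hs θ => ?_
    exact (hasDerivAt_comp_smul ((hf.differentiableOn two_ne_zero).differentiableAt
      (hΩ.mem_nhds (hmem s hs θ)))).const_smul (Y θ)
  have hg2 : ∀ ρ ∈ Ioo a b, HasDerivAt (deriv g) (∫ θ, F2 ρ θ ∂(sphereMeasure d)) ρ := by
    intro ρ hρ
    have hev : deriv g =ᶠ[𝓝 ρ] fun ρ => ∫ θ, F1 ρ θ ∂(sphereMeasure d) := by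
      filter_upwards [isOpen_Ioo.mem_nhds hρ] with s hs using (hg1 s hs).deriv
    refine HasDerivAt.congr_of_eventuallyEq ?_ hev
    refine hasDerivAt_integral_of_continuousOn (sphereMeasure d) isOpen_Ioo hρ hs1 hc2
      fun s hs θ => ?_
    exact (hasDerivAt_fderiv_smul_apply ((hf1.differentiableOn one_ne_zero).differentiableAt
      (hΩ.mem_nhds (hmem s hs θ)))).const_smul (Y θ)
  intro r hr
  refine ⟨(hg1 r hr).differentiableAt, (hg2 r hr).differentiableAt, ?_⟩
  have hr0 : 0 < r := ha.trans hr.1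
  have hzero := integral_laplacian_mul_harmonic hYc hYhom hharm hΩ hf hr0
    (fun x hx => by simpa [annulus, hx] using hr)
  have hInt : ∀ F : sphere (0 : EuclideanSpace ℝ (Fin d)) 1 → ℂ, Continuous F →
      Integrable F (sphereMeasure d) := fun F hF =>
    hF.integrable_of_hasCompactSupport (HasCompactSupport.of_compactSpace _)
  have hLc : Continuous fun θ : sphere (0 : EuclideanSpace ℝ (Fin d)) 1 =>
      Y θ • laplacian f (r • (θ : EuclideanSpace ℝ (Fin d))) := by
    simp only [laplacian_eq_sum]
    refine hYsc.smul (continuous_finsetSum _ fun i _ => ?_)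
    exact ((hf2.comp_continuous (by fun_prop) (hmem r hr)).clm_apply continuous_const).clm_apply
      continuous_const
  have hsplit : ∀ θ : sphere (0 : EuclideanSpace ℝ (Fin d)) 1, Y θ •
      (r ^ 2 • laplacian f (r • (θ : EuclideanSpace ℝ (Fin d))) -
        r ^ 2 • fderiv ℝ (fderiv ℝ f) (r • (θ : EuclideanSpace ℝ (Fin d))) θ θ -
        (((d : ℝ) - 1) * r) • fderiv ℝ f (r • (θ : EuclideanSpace ℝ (Fin d))) θ +
        ((k : ℝ) * (k + d - 2)) • f (r • (θ : EuclideanSpace ℝ (Fin d)))) =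
      r ^ 2 • (Y θ • laplacian f (r • (θ : EuclideanSpace ℝ (Fin d)))) - r ^ 2 • F2 r θ -
        (((d : ℝ) - 1) * r) • F1 r θ + ((k : ℝ) * (k + d - 2)) • F0 r θ := by
    intro θ
    simp only [hF0, hF1, hF2]
    module
  have iL := (hInt _ hLc).smul (r ^ 2)
  have i2 := (hInt _ (hs2 r hr)).smul (r ^ 2)
  have i1 := (hInt _ (hs1 r hr)).smul (((d : ℝ) - 1) * r)
  have i0 := (hInt _ (hs0 r hr)).smul ((k : ℝ) * (k + d - 2))
  simp only [hsplit] at hzero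
  have hadd := integral_add ((iL.sub i2).sub i1) i0
  have hsub1 := integral_sub (iL.sub i2) i1
  have hsub2 := integral_sub iL i2
  simp only [Pi.sub_apply, Pi.smul_apply, integral_smul] at hadd hsub1 hsub2
  rw [hadd, hsub1, hsub2] at hzero
  rw [(hg2 r hr).deriv, (hg1 r hr).deriv, congrFun hgF r]
  have hL : ∫ θ, laplacian f (r • (θ : EuclideanSpace ℝ (Fin d))) *
      ((Y (θ : EuclideanSpace ℝ (Fin d)) : ℝ) : ℂ) ∂(sphereMeasure d) =
      ∫ θ : sphere (0 : EuclideanSpace ℝ (Fin d)) 1,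
        Y θ • laplacian f (r • (θ : EuclideanSpace ℝ (Fin d))) ∂(sphereMeasure d) := by
    simp only [Complex.real_smul, mul_comm]
  rw [hL]
  have hrc : (r : ℂ) ≠ 0 := by exact_mod_cast hr0.ne'
  simp only [Complex.real_smul] at hzero ⊢
  push_cast at hzero
  field_simp
  linear_combination hzero
end
end

section
/- For D = (d-2)/2 > 0 (d > 2), with B_d(ρ) = ρ^{2D}(1-ρ^2)/(1-ρ^{2D}) and G_d(ρ) = 1 + B_d(ρ) - ((D+1)/D)(D B_d(ρ))^{1/(D+1)}, the following limit holds: lim_{ρ→1⁻} G_d(ρ)/(1-ρ)^2 = (D+1)/2. Equivalently, lim_{ρ→1⁻} H_d(ρ) = (D+1)/2 where H_d(ρ) = G_d(ρ)/(1-ρ)^2, and hence (1/(2d)) · lim_{ρ→1⁻} H_d(ρ) = 1/8. -/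
open Set Filter Topology

noncomputable section

/-- The difference quotient of `x ↦ x ^ p` at `1` tends to `p`. -/
theorem tendsto_rpow_sub_one_div (p : ℝ) :
    Tendsto (fun x : ℝ => (x ^ p - 1) / (x - 1)) (𝓝[≠] 1) (𝓝 p) := by
  have h := (Real.hasDerivAt_rpow_const (x := 1) (p := p) (Or.inl one_ne_zero)).tendsto_slope
  simpa [slope_fun_def_field] using h

/-- The second-order Taylor quotient of `x ↦ x ^ p` at `1` tends to `p * (p - 1) / 2`. -/
theorem tendsto_rpow_taylor_two_div_sq (p : ℝ) :
    Tendsto (fun x : ℝ => (x ^ p - 1 - p * (x - 1)) / (x - 1) ^ 2) (𝓝[≠] 1)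
      (𝓝 (p * (p - 1) / 2)) := by
  have hcont : ContinuousAt (fun x : ℝ => x ^ p) 1 :=
    Real.continuousAt_rpow_const 1 p (Or.inl one_ne_zero)
  refine HasDerivAt.lhopital_zero_nhdsNE (f' := fun x => p * x ^ (p - 1) - p)
    (g' := fun x => 2 * (x - 1)) ?_ ?_ ?_ ?_ ?_ ?_
  · filter_upwards [eventually_nhdsWithin_of_eventually_nhds
      (eventually_ne_nhds (one_ne_zero (α := ℝ)))] with x hx
    have h := ((Real.hasDerivAt_rpow_const (p := p) (Or.inl hx)).sub_const 1).fun_sub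
      (((hasDerivAt_id x).sub_const 1).const_mul p)
    simpa using h
  · filter_upwards with x
    have h := ((hasDerivAt_id x).sub_const 1).fun_pow 2
    simpa using h
  · filter_upwards [self_mem_nhdsWithin] with x hx
    exact mul_ne_zero two_ne_zero (sub_ne_zero.mpr hx)
  · have h : ContinuousAt (fun x : ℝ => x ^ p - 1 - p * (x - 1)) 1 := by fun_prop
    simpa [ContinuousAt] using h.tendsto.mono_left nhdsWithin_le_nhds
  · have h : ContinuousAt (fun x : ℝ => (x - 1) ^ 2) 1 := by fun_prop
    simpa [ContinuousAt] using h.tendsto.mono_left nhdsWithin_le_nhds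
  · have h := (tendsto_rpow_sub_one_div (p - 1)).const_mul (p / 2)
    rw [show p / 2 * (p - 1) = p * (p - 1) / 2 by ring] at h
    refine h.congr' ?_
    filter_upwards [self_mem_nhdsWithin] with x hx
    have hx' : x - 1 ≠ 0 := sub_ne_zero.mpr hx
    field_simp

/-- First-order expansion of `a * x ^ (2 * a) * (1 - x ^ 2) / (1 - x ^ (2 * a))` at `1`. -/
theorem tendsto_rpow_ratio_sub_one_div {a : ℝ} (ha : 0 < a) :
    Tendsto (fun x : ℝ => (a * (x ^ (2 * a) * (1 - x ^ 2) / (1 - x ^ (2 * a))) - 1) / (x - 1))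
      (𝓝[<] 1) (𝓝 (a + 1)) := by
  have hle : 𝓝[<] (1 : ℝ) ≤ 𝓝[≠] 1 := nhdsWithin_mono _ fun x hx => ne_of_lt hx
  have h1 := (tendsto_rpow_sub_one_div (2 * a)).mono_left hle
  have h2 := (tendsto_rpow_taylor_two_div_sq (2 * a)).mono_left hle
  have h0 : Tendsto (fun x : ℝ => x ^ (2 * a)) (𝓝[<] 1) (𝓝 1) := by
    simpa [ContinuousAt] using
      (Real.continuousAt_rpow_const 1 (2 * a) (Or.inl one_ne_zero)).tendsto.mono_left
        (nhdsWithin_le_nhds (s := Iio 1))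
  have h := (((h1.const_mul (-(2 * a))).sub (h0.const_mul a)).add h2).div h1.neg
    (by simpa using ha.ne')
  have hlim : (-(2 * a) * (2 * a) - a * 1 + 2 * a * (2 * a - 1) / 2) / -(2 * a) = a + 1 := by
    field_simp
    ring
  rw [hlim] at h
  refine h.congr' ?_
  filter_upwards [Ioo_mem_nhdsLT (zero_lt_one (α := ℝ))] with x hx
  have hx' : x - 1 ≠ 0 := (sub_neg.mpr hx.2).ne
  have hr : 1 - x ^ (2 * a) ≠ 0 :=
    (sub_pos.mpr (Real.rpow_lt_one hx.1.le hx.2 (by positivity))).ne'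
  simp only [Pi.div_apply]
  generalize x ^ (2 * a) = r at hr ⊢
  have hr' : r - 1 ≠ 0 := fun h => hr (by linarith)
  have hr'' : -((r - 1) / (x - 1)) ≠ 0 := neg_ne_zero.mpr (div_ne_zero hr' hx')
  rw [div_eq_iff hr'']
  field_simp
  ring

/-- With `D = (d-2)/2 > 0`, `B_d(ρ) = ρ^{2D}(1-ρ²)/(1-ρ^{2D})` and
`G_d(ρ) = 1 + B_d(ρ) - ((D+1)/D)(D·B_d(ρ))^{1/(D+1)}`, the limit
`lim_{ρ→1⁻} G_d(ρ)/(1-ρ)² = (D+1)/2` holds, i.e. `lim_{ρ→1⁻} H_d(ρ) = (D+1)/2`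
where `H_d(ρ) = G_d(ρ)/(1-ρ)²`; hence `(1/(2d))·lim_{ρ→1⁻} H_d(ρ) = 1/8`. -/
theorem Hd_limit_at_one (d D : ℝ) (hd : 2 < d) (hD : D = (d - 2) / 2)
    (B G : ℝ → ℝ)
    (hB : ∀ ρ : ℝ, B ρ = ρ ^ (2 * D) * (1 - ρ ^ 2) / (1 - ρ ^ (2 * D)))
    (hG : ∀ ρ : ℝ, G ρ = 1 + B ρ - (D + 1) / D * (D * B ρ) ^ (1 / (D + 1))) :
    Tendsto (fun ρ : ℝ => G ρ / (1 - ρ) ^ 2) (𝓝[<] (1 : ℝ)) (𝓝 ((D + 1) / 2)) ∧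
    1 / (2 * d) * ((D + 1) / 2) = 1 / 8 := by
  have hD0 : 0 < D := by rw [hD]; linarith
  refine ⟨?_, ?_⟩
  · have hs : Tendsto (fun ρ => (D * B ρ - 1) / (ρ - 1)) (𝓝[<] 1) (𝓝 (D + 1)) := by
      simpa only [hB] using tendsto_rpow_ratio_sub_one_div hD0
    have hne : ∀ᶠ ρ in 𝓝[<] (1 : ℝ), D * B ρ ≠ 1 := by
      filter_upwards [hs.eventually_ne (by positivity : D + 1 ≠ 0)] with ρ hρ h
      exact hρ (by simp [h])
    have hs1 : Tendsto (fun ρ => D * B ρ) (𝓝[<] 1) (𝓝 1) := by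
      have hu : Tendsto (fun ρ : ℝ => ρ - 1) (𝓝[<] 1) (𝓝 0) := by
        have h : ContinuousAt (fun ρ : ℝ => ρ - 1) 1 := by fun_prop
        simpa [ContinuousAt] using h.tendsto.mono_left (nhdsWithin_le_nhds (s := Iio 1))
      have h := (hs.mul hu).add_const 1
      rw [mul_zero, zero_add] at h
      refine h.congr' ?_
      filter_upwards [self_mem_nhdsWithin] with ρ hρ
      rw [div_mul_cancel₀ _ (sub_neg.mpr hρ).ne, sub_add_cancel]
    have hφ := (tendsto_rpow_taylor_two_div_sq (1 / (D + 1))).comp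
      (tendsto_nhdsWithin_iff.mpr ⟨hs1, hne⟩)
    have h := (hφ.const_mul (-((D + 1) / D))).mul (hs.pow 2)
    have hlim : -((D + 1) / D) * (1 / (D + 1) * (1 / (D + 1) - 1) / 2) * (D + 1) ^ 2
        = (D + 1) / 2 := by
      field_simp
      ring
    rw [hlim] at h
    refine h.congr' ?_
    filter_upwards [hne, self_mem_nhdsWithin] with ρ hρ hρ1
    have hρ' : D * B ρ - 1 ≠ 0 := sub_ne_zero.mpr hρ
    have hu : ρ - 1 ≠ 0 := (sub_neg.mpr hρ1).ne
    rw [hG, ← neg_sub ρ 1, neg_sq]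
    simp only [Function.comp_apply]
    generalize (D * B ρ) ^ (1 / (D + 1)) = w
    field_simp
    ring
  · have hd0 : d ≠ 0 := by linarith
    rw [hD]
    field_simp
    ring
end
end
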